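/- Let H be a closed subgroup of T^d, and suppose H is isomorphic as a topological group to T^{d'} × G₁ × G₂, where G₁ = ∏_{i=1}^{l} ℤ/p^{k_i} (p prime, k_i ≥ 1) and G₂ is a finite abelian group of order coprime to p. If l < d − d', then H is contained in a subgroup of T^d of the form T^{d−1} × F for some codimension-one subtorus T^{d−1} and finite cyclic group F of order coprime to p (after a suitable splitting T^d ≅ T^{d−1} × S¹); if l ≥ d − d', then H contains the subgroup ℤ_p^d of all elements of order dividing p in T^d. -/

import Mathlib

/-- discrete topology on `ZMod n`, used to regard finite groups as topological groups -/
noncomputable local instance (n : ℕ) : TopologicalSpace (ZMod n) := ⊥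

section Torsion

/-- The number of elements `x` with `n • x = 0`. -/
noncomputable def torsionCard (n : ℕ) (G : Type*) [AddMonoid G] : ℕ :=
  Nat.card {x : G // n • x = 0}

theorem torsionCard_congr (n : ℕ) {G G' : Type*} [AddMonoid G] [AddMonoid G'] (e : G ≃+ G') :
    torsionCard n G = torsionCard n G' :=
  Nat.card_congr (e.toEquiv.subtypeEquiv fun x ↦ by
    simp [← map_nsmul])

theorem torsionCard_prod (n : ℕ) (G G' : Type*) [AddMonoid G] [AddMonoid G'] :
    torsionCard n (G × G') = torsionCard n G * torsionCard n G' := by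
  rw [torsionCard, torsionCard, torsionCard, ← Nat.card_prod]
  exact Nat.card_congr ((Equiv.subtypeEquivRight fun x ↦ by simp [Prod.ext_iff]).trans
    Equiv.subtypeProdEquivProd)

theorem torsionCard_pi (n : ℕ) {ι : Type*} [Fintype ι] (G : ι → Type*) [∀ i, AddMonoid (G i)] :
    torsionCard n (∀ i, G i) = ∏ i, torsionCard n (G i) := by
  simp only [torsionCard]
  rw [← Nat.card_pi]
  exact Nat.card_congr ((Equiv.subtypeEquivRight fun x ↦ by simp [funext_iff]).trans
    Equiv.subtypePiEquivPi)

theorem torsionCard_eq_gcd (n : ℕ) (G : Type*) [AddCommGroup G] [IsAddCyclic G] [Finite G] :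
    torsionCard n G = (Nat.card G).gcd n :=
  IsAddCyclic.card_nsmulAddMonoidHom_ker G n

theorem torsionCard_eq_one (n : ℕ) (G : Type*) [AddCommGroup G] [Finite G]
    (h : (Nat.card G).Coprime n) : torsionCard n G = 1 := by
  refine Nat.card_eq_one_iff_unique.2 ⟨⟨fun x y ↦ Subtype.ext ?_⟩, ⟨0, by simp⟩⟩
  have key : ∀ x : {x : G // n • x = 0}, (x : G) = 0 := fun x ↦ by
    rw [← AddMonoid.addOrderOf_eq_one_iff, ← Nat.dvd_one, ← h.gcd_eq_one]
    exact Nat.dvd_gcd (addOrderOf_dvd_natCard _) (addOrderOf_dvd_of_nsmul_eq_zero x.2)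
  rw [key, key]

theorem torsionCard_unitAddCircle (n : ℕ) (hn : 0 < n) : torsionCard n UnitAddCircle = n := by
  have : NeZero n := ⟨hn.ne'⟩
  conv_rhs => rw [← Nat.card_zmod n]
  symm
  refine Nat.card_congr (Equiv.ofBijective
    (fun j : ZMod n ↦
      (⟨ZMod.toAddCircle j, by simp [← map_nsmul]⟩ : {x : UnitAddCircle // n • x = 0}))
    ⟨fun a b h ↦ ZMod.toAddCircle_injective n (congrArg Subtype.val h), ?_⟩)
  rintro ⟨x, hx⟩
  obtain ⟨m, -, rfl⟩ := (AddCircle.nsmul_eq_zero_iff hn).1 hx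
  exact ⟨m, Subtype.ext (by simp [ZMod.toAddCircle_natCast])⟩

theorem AddSubgroup.forall_nsmul_eq_zero_mem_iff {G : Type*} [AddCommGroup G] (H : AddSubgroup G)
    (n : ℕ) (hG : torsionCard n G ≠ 0) :
    (∀ x : G, n • x = 0 → x ∈ H) ↔ torsionCard n G ≤ torsionCard n H := by
  have hfin : Finite {x : G // n • x = 0} := Nat.finite_of_card_ne_zero hG
  let i : {x : H // n • x = 0} → {x : G // n • x = 0} := fun x ↦
    ⟨x.1, by rw [← H.coe_nsmul, x.2, H.coe_zero]⟩
  have hi : Function.Injective i := fun a b h ↦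
    Subtype.ext (Subtype.ext (Subtype.ext_iff.1 h :))
  have : Finite {x : H // n • x = 0} := Finite.of_injective i hi
  refine ⟨fun h ↦ Nat.card_le_card_of_surjective i ?_, fun h x hx ↦ ?_⟩
  · exact fun x ↦ ⟨⟨⟨x.1, h x.1 x.2⟩, Subtype.ext x.2⟩, rfl⟩
  · obtain ⟨y, hy⟩ := ((Nat.bijective_iff_injective_and_card i).2
      ⟨hi, (Nat.card_le_card_of_injective i hi).antisymm h⟩).2 ⟨x, hx⟩
    have : (y.1 : G) = x := congrArg Subtype.val hy
    exact this ▸ y.1.2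

end Torsion

section Duality

open MeasureTheory

theorem UnitAddTorus.mFourier_apply_eq_toCircle {ι : Type*} [Fintype ι] (a : ι → ℤ)
    (x : UnitAddTorus ι) : mFourier a x = (AddCircle.toCircle (∑ i, a i • x i) : ℂ) := by
  have h := map_sum (AddCircle.toCircle_addChar (T := 1)).toAddMonoidHom
    (fun i ↦ a i • x i) Finset.univ
  have h' : AddCircle.toCircle (∑ i, a i • x i) = ∏ i, AddCircle.toCircle (a i • x i) := h
  exact (map_prod Circle.coeHom (fun i ↦ AddCircle.toCircle (a i • x i)) Finset.univ).symm.trans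
    (congrArg Circle.coeHom h'.symm)

theorem UnitAddTorus.mFourier_add_apply {ι : Type*} [Fintype ι] (a : ι → ℤ)
    (x y : UnitAddTorus ι) : mFourier a (x + y) = mFourier a x * mFourier a y := by
  simp only [mFourier_apply_eq_toCircle, Pi.add_apply, smul_add, Finset.sum_add_distrib,
    AddCircle.toCircle_add, Circle.coe_mul]

theorem UnitAddTorus.mFourier_apply_eq_one_iff {ι : Type*} [Fintype ι] (a : ι → ℤ)
    (x : UnitAddTorus ι) : mFourier a x = 1 ↔ ∑ i, a i • x i = 0 := by
  rw [mFourier_apply_eq_toCircle, Circle.coe_eq_one, ← AddCircle.toCircle_zero (T := 1),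
    (AddCircle.injective_toCircle one_ne_zero).eq_iff]

/-- A point of the torus killed by all characters that kill a closed subgroup lies in
that subgroup. -/
theorem UnitAddTorus.mem_of_forall_character {ι : Type*} [Fintype ι]
    (H : AddSubgroup (UnitAddTorus ι)) (hH : IsClosed (H : Set (UnitAddTorus ι)))
    (x : UnitAddTorus ι)
    (hx : ∀ a : ι → ℤ, (∀ h ∈ H, ∑ i, a i • h i = 0) → ∑ i, a i • x i = 0) : x ∈ H := by
  have : CompactSpace H := isCompact_iff_compactSpace.1 hH.isCompact
  let : MeasurableSpace H := borel H
  have : BorelSpace H := ⟨rfl⟩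
  let μ : Measure H := Measure.addHaar
  have hint : ∀ f : C(UnitAddTorus ι, ℂ), ∀ y, Integrable (fun h : H ↦ f (y + h)) μ := fun f y ↦
    Continuous.integrable_of_hasCompactSupport (by fun_prop) (HasCompactSupport.of_compactSpace _)
  let avg : UnitAddTorus ι → C(UnitAddTorus ι, ℂ) →ₗ[ℂ] ℂ := fun y ↦
    { toFun := fun f ↦ ∫ h : H, f (y + h) ∂μ
      map_add' := fun f g ↦ integral_add (hint f y) (hint g y)
      map_smul' := fun c f ↦ integral_const_mul c _ }
  have hcont : ∀ y, Continuous (avg y) := fun y ↦ by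
    refine ((avg y).mkContinuous (μ.real Set.univ) fun f ↦ ?_).continuous
    rw [mul_comm]
    exact norm_integral_le_of_norm_le_const (.of_forall fun h ↦ f.norm_coe_le_norm _)
  have hchar : ∀ a, avg x (mFourier a) = avg 0 (mFourier a) := fun a ↦ by
    have hmul : ∀ y, avg y (mFourier a) = mFourier a y * ∫ h : H, mFourier a h ∂μ := fun y ↦ by
      rw [← integral_const_mul]
      exact integral_congr_ae (.of_forall fun h ↦ mFourier_add_apply a y h)
    rw [hmul, hmul]
    by_cases ha : ∀ h ∈ H, ∑ i, a i • h i = 0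
    · rw [(mFourier_apply_eq_one_iff a x).2 (hx a ha),
        (mFourier_apply_eq_one_iff a 0).2 (by simp)]
    · push Not at ha
      obtain ⟨g, hg, hne⟩ := ha
      have hinv : ∫ h : H, mFourier a h ∂μ = mFourier a g * ∫ h : H, mFourier a h ∂μ := by
        rw [← integral_const_mul, ← integral_add_left_eq_self _ (⟨g, hg⟩ : H)]
        exact integral_congr_ae (.of_forall fun h ↦ mFourier_add_apply a g h)
      have hzero : ∫ h : H, mFourier a h ∂μ = 0 := by
        by_contra h0
        exact hne ((mFourier_apply_eq_one_iff a g).1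
          (mul_right_cancel₀ h0 (by rw [← hinv, one_mul])))
      rw [hzero, mul_zero, mul_zero]
  have heq : ∀ f, avg x f = avg 0 f := fun f ↦ by
    have hle : (Submodule.span ℂ (Set.range <| mFourier (d := ι))).topologicalClosure ≤
        LinearMap.eqLocus (avg x) (avg 0) :=
      Submodule.topologicalClosure_minimal _
        (Submodule.span_le.2 (Set.range_subset_iff.2 hchar))
        (isClosed_eq (hcont x) (hcont 0))
    rw [span_mFourier_closure_eq_top] at hle
    exact hle trivial
  by_contra hxH
  have hclosed : IsClosed ((fun y ↦ -x + y) ⁻¹' (H : Set (UnitAddTorus ι))) :=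
    hH.preimage (by fun_prop)
  obtain ⟨f, hf0, hf1, -⟩ := exists_continuous_zero_one_of_isClosed hH hclosed (by
    refine Set.disjoint_left.2 fun y hy hy' ↦ hxH ?_
    simpa using H.sub_mem hy hy')
  have h0 : avg 0 ⟨fun y ↦ (f y : ℂ), by fun_prop⟩ = 0 :=
    integral_eq_zero_of_ae (.of_forall fun h ↦ by simp [hf0 h.2])
  have h1 : avg x ⟨fun y ↦ (f y : ℂ), by fun_prop⟩ = ∫ _ : H, (1 : ℂ) ∂μ :=
    integral_congr_ae (.of_forall fun h ↦ by
      have : f (x + h) = 1 := hf1 (by simp)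
      simp [this])
  rw [heq, h0, integral_const] at h1
  have hpos : 0 < μ.real Set.univ :=
    ENNReal.toReal_pos (isOpen_univ.measure_pos μ ⟨0, trivial⟩).ne' (measure_ne_top μ _)
  simp only [Complex.real_smul, mul_one] at h1
  exact hpos.ne (by exact_mod_cast h1)

end Duality

section Splitting

/-- The action of an integer matrix on vectors with entries in an abelian group. -/
def Matrix.zsmulVec {ι κ : Type*} [Fintype ι] (M : Matrix κ ι ℤ) {A : Type*}
    [AddCommGroup A] (x : ι → A) (k : κ) : A :=
  ∑ i, M k i • x i

theorem Matrix.zsmulVec_zsmulVec {ι κ l : Type*} [Fintype ι] [Fintype κ] (M : Matrix l κ ℤ)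
    (N : Matrix κ ι ℤ) {A : Type*} [AddCommGroup A] (x : ι → A) :
    M.zsmulVec (N.zsmulVec x) = (M * N).zsmulVec x := by
  ext k
  simp only [zsmulVec, mul_apply, Finset.smul_sum, Finset.sum_smul, mul_smul]
  exact Finset.sum_comm

theorem Matrix.one_zsmulVec {ι : Type*} [Fintype ι] [DecidableEq ι] {A : Type*} [AddCommGroup A]
    (x : ι → A) : (1 : Matrix ι ι ℤ).zsmulVec x = x := by
  ext k
  simp [zsmulVec, one_apply, ite_smul]

/-- The isomorphism of powers of an abelian group given by an invertible integer matrix. -/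
def Matrix.zsmulVecEquiv {ι κ : Type*} [Fintype ι] [Fintype κ] [DecidableEq ι] [DecidableEq κ]
    (M : Matrix κ ι ℤ) (N : Matrix ι κ ℤ) (hMN : M * N = 1) (hNM : N * M = 1)
    (A : Type*) [AddCommGroup A] : (ι → A) ≃+ (κ → A) where
  toFun := M.zsmulVec
  invFun := N.zsmulVec
  left_inv x := by rw [zsmulVec_zsmulVec, hNM, one_zsmulVec]
  right_inv x := by rw [zsmulVec_zsmulVec, hMN, one_zsmulVec]
  map_add' x y := by ext k; simp [zsmulVec, Finset.sum_add_distrib]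

@[fun_prop]
theorem Matrix.continuous_zsmulVec {ι κ : Type*} [Fintype ι] (M : Matrix κ ι ℤ) {A : Type*}
    [AddCommGroup A] [TopologicalSpace A] [IsTopologicalAddGroup A] :
    Continuous (M.zsmulVec : (ι → A) → κ → A) := by
  unfold Matrix.zsmulVec
  fun_prop

/-- A surjective functional on `ℤ^d` is the last coordinate in some basis. -/
theorem exists_linearEquiv_snd_eq {d : ℕ} (f : (Fin d → ℤ) →ₗ[ℤ] ℤ) (w : Fin d → ℤ)
    (hw : f w = 1) :
    ∃ E : (Fin d → ℤ) ≃ₗ[ℤ] (Fin (d - 1) → ℤ) × ℤ, ∀ x, (E x).2 = f x := by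
  let E₁ : (Fin d → ℤ) ≃ₗ[ℤ] LinearMap.ker f × ℤ :=
    { toFun := fun x ↦ (⟨x - f x • w, by simp [-zsmul_eq_mul, hw]⟩, f x)
      map_add' := fun x y ↦ by
        ext <;> simp [-zsmul_eq_mul, add_smul]
        ring
      map_smul' := fun c x ↦ by
        ext <;> simp [-zsmul_eq_mul, mul_sub, mul_assoc]
      invFun := fun y ↦ y.1 + y.2 • w
      left_inv := fun x ↦ by simp
      right_inv := fun y ↦ by
        have h : f y.1 = 0 := y.1.2
        ext <;> simp [-zsmul_eq_mul, hw, h] }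
  have hrank : Module.finrank ℤ (LinearMap.ker f) = Module.finrank ℤ (Fin (d - 1) → ℤ) := by
    have h := E₁.finrank_eq
    rw [Module.finrank_prod, Module.finrank_self, Module.finrank_fin_fun] at h
    rw [Module.finrank_fin_fun]
    omega
  let E₂ := LinearEquiv.ofFinrankEq _ _ hrank
  exact ⟨E₁.trans (E₂.prodCongr (LinearEquiv.refl ℤ ℤ)), fun x ↦ rfl⟩

/-- A unimodular vector gives the last coordinate of a splitting of the power `A^d` of a
topological abelian group `A`. -/
theorem exists_split_addEquiv {d : ℕ} (v w : Fin d → ℤ) (hw : ∑ i, v i * w i = 1)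
    (A : Type*) [AddCommGroup A] [TopologicalSpace A] [IsTopologicalAddGroup A] :
    ∃ φ : (Fin d → A) ≃+ (Fin (d - 1) → A) × A, Continuous φ ∧ Continuous φ.symm ∧
      ∀ x, (φ x).2 = ∑ i, v i • x i := by
  obtain ⟨E, hE⟩ := exists_linearEquiv_snd_eq (Fintype.linearCombination ℤ v) w
    (by simpa [Fintype.linearCombination_apply, mul_comm] using hw)
  let F : (Fin d → ℤ) ≃ₗ[ℤ] (Fin (d - 1) ⊕ Unit → ℤ) := E.trans
    (((LinearEquiv.refl ℤ _).prodCongr (LinearEquiv.funUnique Unit ℤ ℤ).symm).trans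
      (LinearEquiv.sumArrowLequivProdArrow _ _ ℤ ℤ).symm)
  let Φ := Matrix.zsmulVecEquiv (LinearMap.toMatrix' F.toLinearMap)
    (LinearMap.toMatrix' F.symm.toLinearMap)
    (by rw [← LinearMap.toMatrix'_comp, LinearEquiv.comp_symm, LinearMap.toMatrix'_id])
    (by rw [← LinearMap.toMatrix'_comp, LinearEquiv.symm_comp, LinearMap.toMatrix'_id]) A
  let Ψ : (Fin (d - 1) ⊕ Unit → A) ≃+ (Fin (d - 1) → A) × A :=
    { toFun := fun x ↦ (fun i ↦ x (.inl i), x (.inr ()))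
      invFun := fun y ↦ Sum.elim y.1 fun _ ↦ y.2
      left_inv := fun x ↦ by ext (i | i) <;> rfl
      right_inv := fun y ↦ rfl
      map_add' := fun x y ↦ rfl }
  have hΨ : Continuous Ψ := by
    change Continuous fun x : Fin (d - 1) ⊕ Unit → A ↦ (fun i ↦ x (.inl i), x (.inr ()))
    fun_prop
  have hΨ' : Continuous Ψ.symm := by
    refine continuous_pi ?_
    rintro (i | i)
    · exact (continuous_apply i).comp continuous_fst
    · exact continuous_snd
  refine ⟨Φ.trans Ψ, hΨ.comp (Matrix.continuous_zsmulVec _),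
    (Matrix.continuous_zsmulVec _).comp hΨ', fun x ↦ ?_⟩
  change ∑ i, LinearMap.toMatrix' F.toLinearMap (.inr ()) i • x i = _
  refine Finset.sum_congr rfl fun i _ ↦ ?_
  congr 1
  have : F (Pi.single i 1) (.inr ()) = (E (Pi.single i 1)).2 := rfl
  rw [LinearMap.toMatrix'_apply]
  refine this.trans ?_
  simp [hE, Fintype.linearCombination_apply_single]

/-- A nonzero integer vector is a multiple of a unimodular one. -/
theorem exists_eq_mul_unimodular {ι : Type*} [Fintype ι] (a : ι → ℤ) (ha : a ≠ 0) :
    ∃ (m : ℕ) (v w : ι → ℤ), (∀ i, a i = m * v i) ∧ ∑ i, v i * w i = 1 := by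
  obtain ⟨g, hg⟩ := IsPrincipalIdealRing.principal (Ideal.span (Set.range a))
  have hdvd : ∀ i, ∃ u, a i = g * u := fun i ↦ by
    have : a i ∈ Ideal.span (Set.range a) := Ideal.subset_span ⟨i, rfl⟩
    rw [hg] at this
    exact Ideal.mem_span_singleton.1 this
  choose u hu using hdvd
  have hg0 : g ≠ 0 := by
    rintro rfl
    exact ha (funext fun i ↦ by simp [hu i])
  have hmem : g ∈ Ideal.span (Set.range a) := hg ▸ Ideal.mem_span_singleton_self g
  obtain ⟨c, hc⟩ := (Ideal.mem_span_range_iff_exists_fun).1 hmem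
  have huc : ∑ i, u i * c i = 1 := by
    refine mul_left_cancel₀ hg0 ?_
    rw [mul_one, Finset.mul_sum]
    refine (Finset.sum_congr rfl fun i _ ↦ ?_).trans hc
    rw [hu i]; ring
  have hs : g.sign * g.sign = 1 := by
    rcases lt_or_gt_of_ne hg0 with h | h
    · simp [Int.sign_eq_neg_one_of_neg h]
    · simp [Int.sign_eq_one_of_pos h]
  refine ⟨g.natAbs, fun i ↦ g.sign * u i, fun i ↦ g.sign * c i, fun i ↦ ?_, ?_⟩
  · rw [hu i, ← mul_assoc, mul_comm (g.natAbs : ℤ), Int.sign_mul_natAbs]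
  · rw [← huc]
    refine Finset.sum_congr rfl fun i _ ↦ ?_
    linear_combination u i * c i * hs

end Splitting

/-- Let `H` be a closed subgroup of `T^d` isomorphic (as a topological group)
to `T^{d'} × ∏ ℤ/p^{kᵢ} × G₂` with `G₂` finite of order coprime to `p`. If `l < d − d'`
then, after a suitable splitting `T^d ≅ T^{d−1} × S¹`, `H` is contained in
`T^{d−1} × F` with `F` finite cyclic of order coprime to `p`; if `l ≥ d − d'` then `H`
contains the `p`-torsion subgroup `ℤ_p^d` of `T^d`. -/
theorem stmt_3 (p : ℕ) (hp : p.Prime) (d d' l : ℕ) (kk : Fin l → ℕ) (hkk : ∀ i, 1 ≤ kk i)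
    (G₂ : Type) [AddCommGroup G₂] [Fintype G₂] [TopologicalSpace G₂] [DiscreteTopology G₂]
    (hG₂ : ¬ (p ∣ Fintype.card G₂))
    (H : AddSubgroup (Fin d → AddCircle (1 : ℝ)))
    (hclosed : IsClosed (H : Set (Fin d → AddCircle (1 : ℝ))))
    (e : H ≃+ ((Fin d' → AddCircle (1 : ℝ)) × (∀ i : Fin l, ZMod (p ^ kk i)) × G₂))
    (he : Continuous e) (he' : Continuous e.symm) :
    (l < d - d' →
      ∃ φ : (Fin d → AddCircle (1 : ℝ)) ≃+ ((Fin (d - 1) → AddCircle (1 : ℝ)) × AddCircle (1 : ℝ)),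
        Continuous φ ∧ Continuous φ.symm ∧
        ∃ m : ℕ, 0 < m ∧ ¬ (p ∣ m) ∧ ∀ h ∈ H, m • (φ h).2 = 0) ∧
    (d - d' ≤ l →
      ∀ x : Fin d → AddCircle (1 : ℝ), p • x = 0 → x ∈ H) := by
  have hcardT : torsionCard p (Fin d → AddCircle (1 : ℝ)) = p ^ d := by
    simp [torsionCard_pi, torsionCard_unitAddCircle p hp.pos]
  have hcardZ (i : Fin l) : torsionCard p (ZMod (p ^ kk i)) = p := by
    have : NeZero (p ^ kk i) := ⟨(pow_pos hp.pos _).ne'⟩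
    rw [torsionCard_eq_gcd, Nat.card_zmod]
    exact Nat.gcd_eq_right (dvd_pow_self p (Nat.one_le_iff_ne_zero.1 (hkk i)))
  have hcardG : torsionCard p G₂ = 1 := torsionCard_eq_one p G₂ (by
    rw [Nat.card_eq_fintype_card]
    exact ((Nat.Prime.coprime_iff_not_dvd hp).2 hG₂).symm)
  have hcardH : torsionCard p H = p ^ (d' + l) := by
    rw [torsionCard_congr p e, torsionCard_prod, torsionCard_prod, torsionCard_pi, torsionCard_pi,
      hcardG]
    simp [torsionCard_unitAddCircle p hp.pos, hcardZ, pow_add]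
  have hiff : (∀ x : Fin d → AddCircle (1 : ℝ), p • x = 0 → x ∈ H) ↔ d ≤ d' + l := by
    rw [H.forall_nsmul_eq_zero_mem_iff p (hcardT ▸ (pow_pos hp.pos _).ne'), hcardT, hcardH,
      Nat.pow_le_pow_iff_right hp.one_lt]
  refine ⟨fun hl ↦ ?_, fun hl ↦ hiff.2 (by omega)⟩
  obtain ⟨a, haH, hap⟩ : ∃ a : Fin d → ℤ, (∀ h ∈ H, ∑ i, a i • h i = 0) ∧
      ¬ ∀ i, (p : ℤ) ∣ a i := by
    by_contra! hcon
    have hle := hiff.1 fun x hx ↦ UnitAddTorus.mem_of_forall_character H hclosed x fun a ha ↦ by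
      choose b hb using hcon a ha
      refine Finset.sum_eq_zero fun i _ ↦ ?_
      have hxi : p • x i = 0 := congrFun hx i
      rw [hb i, mul_comm, mul_smul, natCast_zsmul, hxi, smul_zero]
    omega
  have ha0 : a ≠ 0 := by
    rintro rfl
    exact hap fun i ↦ dvd_zero _
  obtain ⟨m, v, w, hav, hvw⟩ := exists_eq_mul_unimodular a ha0
  obtain ⟨φ, hφ, hφ', hsnd⟩ := exists_split_addEquiv v w hvw (AddCircle (1 : ℝ))
  refine ⟨φ, hφ, hφ', m, Nat.pos_of_ne_zero ?_, fun hpm ↦ hap fun i ↦ ?_, fun h hh ↦ ?_⟩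
  · rintro rfl
    exact ha0 (funext fun i ↦ by simp [hav i])
  · rw [hav i]
    exact (Int.natCast_dvd_natCast.2 hpm).mul_right _
  · rw [hsnd, ← haH h hh, Finset.smul_sum]
    refine Finset.sum_congr rfl fun i _ ↦ ?_
    rw [hav i, mul_smul, natCast_zsmul]
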